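/- arXiv:0802.2850 — 3 statements merged into one kernel-verified Lean document; each statement's English description precedes it below -/
import Mathlib

section
/- Let G be a finite bipartite simple graph and w an integer weight function on its edges. Suppose that every cycle of G has nonzero circulation, i.e., for every closed walk with pairwise distinct vertices and edges e₀, …, e_{m−1} one has Σ_{k<m} (−1)^k w(e_k) ≠ 0. Then G has at most one perfect matching of minimum total weight: if M₁ and M₂ are perfect matchings such that each minimizes Σ_{e∈M} w(e) over all perfect matchings M of G, then M₁ = M₂. -/
/-- `M` is a perfect matching of `G`: a set of edges of `G` such that every vertex is
incident to exactly one edge of `M`. -/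
def IsPerfectMatching' {V : Type*} (G : SimpleGraph V) (M : Finset (Sym2 V)) : Prop :=
  (∀ e ∈ M, e ∈ G.edgeSet) ∧ ∀ v : V, ∃! e, e ∈ M ∧ v ∈ e

/-- A perfect matching is described by its partner map. -/
theorem IsPerfectMatching'.exists_partner {V : Type*} {G : SimpleGraph V} {M : Finset (Sym2 V)}
    (h : IsPerfectMatching' G M) :
    ∃ m : V → V, (∀ x, G.Adj x (m x)) ∧ (∀ x, m (m x) = x) ∧
      ∀ x y, s(x, y) ∈ M ↔ m x = y := by
  have key : ∀ x, ∃ y, s(x, y) ∈ M := by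
    intro x
    obtain ⟨e, ⟨he, hx⟩, -⟩ := h.2 x
    obtain ⟨y, rfl⟩ := Sym2.mem_iff_exists.1 hx
    exact ⟨y, he⟩
  choose m hm using key
  have hiff : ∀ x y, s(x, y) ∈ M ↔ m x = y := by
    intro x y
    refine ⟨fun hy => ?_, fun hy => hy ▸ hm x⟩
    have := (h.2 x).unique ⟨hm x, Sym2.mem_mk_left _ _⟩ ⟨hy, Sym2.mem_mk_left _ _⟩
    exact Sym2.congr_right.1 this
  refine ⟨m, fun x => h.1 _ (hm x), fun x => ?_, hiff⟩
  rw [← hiff, Sym2.eq_swap]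
  exact hm x

/-- A fixed-point-free involution along edges of `G` gives a perfect matching. -/
theorem isPerfectMatching'_image {V : Type*} [Fintype V] [DecidableEq V] {G : SimpleGraph V}
    {m : V → V} (hadj : ∀ x, G.Adj x (m x)) (hinv : ∀ x, m (m x) = x) :
    IsPerfectMatching' G (Finset.univ.image fun x => s(x, m x)) := by
  refine ⟨?_, fun v =>
    ⟨s(v, m v), ⟨Finset.mem_image_of_mem _ (Finset.mem_univ v), Sym2.mem_mk_left _ _⟩, ?_⟩⟩
  · intro e he
    obtain ⟨x, -, rfl⟩ := Finset.mem_image.1 he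
    exact hadj x
  · rintro e ⟨he, hv⟩
    obtain ⟨x, -, rfl⟩ := Finset.mem_image.1 he
    rcases Sym2.mem_iff.1 hv with rfl | rfl
    · rfl
    · rw [hinv, Sym2.eq_swap]

/-- The weight of a perfect matching, as a sum over one colour class. -/
theorem sum_matching_eq_sum_color {V : Type*} [Fintype V] {G : SimpleGraph V}
    (c : G.Coloring (Fin 2)) (a : Fin 2) (w : Sym2 V → ℤ) {M : Finset (Sym2 V)} {m : V → V}
    (hadj : ∀ x, G.Adj x (m x)) (hiff : ∀ x y, s(x, y) ∈ M ↔ m x = y) :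
    ∑ e ∈ M, w e = ∑ x with c x = a, w s(x, m x) := by
  symm
  refine Finset.sum_nbij (fun x => s(x, m x)) ?_ ?_ ?_ fun _ _ => rfl
  · intro x _
    exact (hiff _ _).2 rfl
  · intro x hx y hy hxy
    have hx : c x = a := by simpa using hx
    have hy : c y = a := by simpa using hy
    rcases Sym2.eq_iff.1 hxy with h | h
    · exact h.1
    · exact absurd (hy.trans (hx.symm.trans (congrArg c h.1))) (c.valid (hadj y))
  · intro e he
    induction e using Sym2.ind with
    | _ x y =>
      have hxy : m x = y := (hiff x y).1 he
      have hyx : m y = x := (hiff y x).1 (Sym2.eq_swap ▸ he)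
      have hne : c x ≠ c y := hxy ▸ c.valid (hadj x)
      by_cases hx : c x = a
      · exact ⟨x, by simpa using hx, by simp [hxy]⟩
      · exact ⟨y, by simp; omega, by simp [hyx, Sym2.eq_swap]⟩

/-- On a set closed under both partner maps, a minimum weight perfect matching is at most as
heavy as any other perfect matching. -/
theorem sum_partner_le_of_invariant {V : Type*} [Fintype V] {G : SimpleGraph V}
    (c : G.Coloring (Fin 2)) (a : Fin 2) (w : Sym2 V → ℤ) {M : Finset (Sym2 V)}
    (hmin : ∀ M', IsPerfectMatching' G M' → ∑ e ∈ M, w e ≤ ∑ e ∈ M', w e) {m m' : V → V}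
    (hadj : ∀ x, G.Adj x (m x)) (hinv : ∀ x, m (m x) = x)
    (hiff : ∀ x y, s(x, y) ∈ M ↔ m x = y)
    (hadj' : ∀ x, G.Adj x (m' x)) (hinv' : ∀ x, m' (m' x) = x)
    (S : V → Prop) [DecidablePred S] (hS : ∀ x, S x → S (m x)) (hS' : ∀ x, S x → S (m' x)) :
    ∑ x with c x = a ∧ S x, w s(x, m x) ≤ ∑ x with c x = a ∧ S x, w s(x, m' x) := by
  classical
  let n : V → V := fun x => if S x then m' x else m x
  have hn : ∀ x, G.Adj x (n x) := by
    intro x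
    dsimp only [n]
    split_ifs
    exacts [hadj' x, hadj x]
  have hninv : ∀ x, n (n x) = x := by
    intro x
    dsimp only [n]
    by_cases hx : S x
    · simp [hx, hS' x hx, hinv']
    · have : ¬ S (m x) := fun h => hx (hinv x ▸ hS _ h)
      simp [hx, this, hinv]
  have hle := hmin _ (isPerfectMatching'_image hn hninv)
  rw [sum_matching_eq_sum_color c a w hadj hiff,
    sum_matching_eq_sum_color c a w hn (fun x y => ?_)] at hle
  · rw [← Finset.sum_filter_add_sum_filter_not _ S,
      ← Finset.sum_filter_add_sum_filter_not (Finset.univ.filter fun x => c x = a) S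
        (fun x => w s(x, n x)), Finset.filter_filter, Finset.filter_filter] at hle
    have h₁ : ∑ x with c x = a ∧ S x, w s(x, n x) = ∑ x with c x = a ∧ S x, w s(x, m' x) :=
      Finset.sum_congr rfl fun x hx => by simp [n, (Finset.mem_filter.1 hx).2.2]
    have h₂ : ∑ x with c x = a ∧ ¬ S x, w s(x, n x) = ∑ x with c x = a ∧ ¬ S x, w s(x, m x) :=
      Finset.sum_congr rfl fun x hx => by simp [n, (Finset.mem_filter.1 hx).2.2]
    linarith
  · constructor
    · intro h
      obtain ⟨z, -, hz⟩ := Finset.mem_image.1 h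
      rcases Sym2.eq_iff.1 hz with ⟨rfl, hy⟩ | ⟨rfl, rfl⟩
      · exact hy
      · exact hninv _
    · rintro rfl
      exact Finset.mem_image_of_mem _ (Finset.mem_univ x)

/-- The walk following alternately `m` and `m'`, of length `2 * k`. -/
def alternatingWalk {V : Type*} {G : SimpleGraph V} {m m' : V → V}
    (hadj : ∀ x, G.Adj x (m x)) (hadj' : ∀ x, G.Adj x (m' x)) :
    (k : ℕ) → (x : V) → G.Walk x ((m' ∘ m)^[k] x)
  | 0, _ => SimpleGraph.Walk.nil
  | k + 1, x => SimpleGraph.Walk.cons (hadj x) (SimpleGraph.Walk.cons (hadj' (m x))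
      ((alternatingWalk hadj hadj' k (m' (m x))).copy rfl
        (Function.iterate_succ_apply _ _ _).symm))

theorem alternatingSum_edges_alternatingWalk {V : Type*} {G : SimpleGraph V} {m m' : V → V}
    (hadj : ∀ x, G.Adj x (m x)) (hadj' : ∀ x, G.Adj x (m' x)) (w : Sym2 V → ℤ) (k : ℕ) (x : V) :
    ((alternatingWalk hadj hadj' k x).edges.map w).alternatingSum =
      ∑ i ∈ Finset.range k, (w s((m' ∘ m)^[i] x, m ((m' ∘ m)^[i] x)) -
        w s(m ((m' ∘ m)^[i] x), (m' ∘ m)^[i + 1] x)) := by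
  induction k generalizing x with
  | zero => simp [alternatingWalk]
  | succ k ih =>
    rw [Finset.sum_range_succ', alternatingWalk]
    simp only [SimpleGraph.Walk.edges_cons, SimpleGraph.Walk.edges_copy,
      List.map_cons, List.alternatingSum_cons_cons, ih]
    simp only [Function.iterate_succ_apply, Function.iterate_zero, id, Function.comp_apply]
    ring

theorem mem_support_alternatingWalk {V : Type*} {G : SimpleGraph V} {m m' : V → V}
    (hadj : ∀ x, G.Adj x (m x)) (hadj' : ∀ x, G.Adj x (m' x)) (k : ℕ) (x y : V)
    (hy : y ∈ (alternatingWalk hadj hadj' k x).support) :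
    (∃ i ≤ k, y = (m' ∘ m)^[i] x) ∨ ∃ i < k, y = m ((m' ∘ m)^[i] x) := by
  induction k generalizing x with
  | zero => exact .inl ⟨0, le_rfl, by simpa [alternatingWalk] using hy⟩
  | succ k ih =>
    simp only [alternatingWalk, SimpleGraph.Walk.support_cons, SimpleGraph.Walk.support_copy,
      List.mem_cons] at hy
    rcases hy with rfl | rfl | hy
    · exact .inl ⟨0, by omega, rfl⟩
    · exact .inr ⟨0, by omega, rfl⟩
    · rcases ih _ hy with ⟨i, hi, h⟩ | ⟨i, hi, h⟩
      · exact .inl ⟨i + 1, by omega, h⟩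
      · exact .inr ⟨i + 1, by omega, h⟩

theorem color_iterate_partner_comp {V : Type*} {G : SimpleGraph V} {m m' : V → V}
    (c : G.Coloring (Fin 2)) (hadj : ∀ x, G.Adj x (m x)) (hadj' : ∀ x, G.Adj x (m' x))
    (i : ℕ) (x : V) : c ((m' ∘ m)^[i] x) = c x := by
  induction i generalizing x with
  | zero => rfl
  | succ i ih =>
    rw [Function.iterate_succ_apply, ih]
    have h₁ := c.valid (hadj x)
    have h₂ := c.valid (hadj' (m x))
    simp only [Function.comp_apply]
    omega

theorem partner_notMem_support_alternatingWalk {V : Type*} {G : SimpleGraph V} {m m' : V → V}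
    (c : G.Coloring (Fin 2)) (hadj : ∀ x, G.Adj x (m x)) (hadj' : ∀ x, G.Adj x (m' x))
    (hinv : ∀ x, m (m x) = x) (k : ℕ) (x : V)
    (hx : ∀ i < k, (m' ∘ m)^[i + 1] x ≠ x) :
    m x ∉ (alternatingWalk hadj hadj' k (m' (m x))).support := by
  intro h
  rcases mem_support_alternatingWalk hadj hadj' _ _ _ h with ⟨i, hi, h⟩ | ⟨i, hi, h⟩
  · have := color_iterate_partner_comp c hadj hadj' (i + 1) x
    rw [Function.iterate_succ_apply, Function.comp_apply, ← h] at this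
    exact c.valid (hadj x) this.symm
  · have := congrArg m h
    rw [hinv, hinv] at this
    exact hx i hi this.symm

theorem isPath_alternatingWalk {V : Type*} {G : SimpleGraph V} {m m' : V → V}
    (c : G.Coloring (Fin 2)) (hadj : ∀ x, G.Adj x (m x)) (hadj' : ∀ x, G.Adj x (m' x))
    (hinv : ∀ x, m (m x) = x) (k : ℕ) (x : V)
    (hx : Set.InjOn (fun i => (m' ∘ m)^[i] x) (Set.Iic k)) :
    (alternatingWalk hadj hadj' k x).IsPath := by
  induction k generalizing x with
  | zero => simp [alternatingWalk]
  | succ k ih =>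
    have hne : ∀ i ≤ k, (m' ∘ m)^[i + 1] x ≠ x := fun i hi h => by
      have := hx (x₁ := i + 1) (x₂ := 0) (by simpa using hi) (by simp) h
      omega
    rw [alternatingWalk, SimpleGraph.Walk.cons_isPath_iff, SimpleGraph.Walk.cons_isPath_iff,
      SimpleGraph.Walk.isPath_copy, SimpleGraph.Walk.support_cons, SimpleGraph.Walk.support_copy]
    refine ⟨⟨ih _ fun i hi j hj h => ?_,
      partner_notMem_support_alternatingWalk c hadj hadj' hinv k x fun i hi => hne i hi.le⟩, ?_⟩
    · have := hx (x₁ := i + 1) (x₂ := j + 1) (by simpa using hi) (by simpa using hj) h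
      omega
    · rw [List.mem_cons, not_or]
      refine ⟨(hadj x).ne, fun h => ?_⟩
      rcases mem_support_alternatingWalk hadj hadj' _ _ _ h with ⟨i, hi, h⟩ | ⟨i, hi, h⟩
      · exact hne i hi h.symm
      · have h₁ := color_iterate_partner_comp c hadj hadj' (i + 1) x
        have h₂ := c.valid (hadj ((m' ∘ m)^[i + 1] x))
        rw [h₁] at h₂
        exact h₂ (congrArg c h)

/-- Following two partner maps alternately for one full period gives a cycle. -/
theorem isCycle_copy_alternatingWalk {V : Type*} {G : SimpleGraph V} {m m' : V → V}
    (c : G.Coloring (Fin 2)) (hadj : ∀ x, G.Adj x (m x)) (hadj' : ∀ x, G.Adj x (m' x))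
    (hinv : ∀ x, m (m x) = x) (k : ℕ) (x : V)
    (hper : (m' ∘ m)^[k + 1] x = x) (hne : m' (m x) ≠ x)
    (hx : Set.InjOn (fun i => (m' ∘ m)^[i] x) (Set.Iio (k + 1))) :
    ((alternatingWalk hadj hadj' (k + 1) x).copy rfl hper).IsCycle := by
  have hk : ∀ i < k, (m' ∘ m)^[i + 1] x ≠ x := fun i hi h => by
    have := hx (x₁ := i + 1) (x₂ := 0) (by simpa using hi) (by simp) h
    omega
  have hnot := partner_notMem_support_alternatingWalk c hadj hadj' hinv k x hk
  rw [alternatingWalk, SimpleGraph.Walk.copy_cons, SimpleGraph.Walk.cons_isCycle_iff]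
  rw [SimpleGraph.Walk.isPath_copy, SimpleGraph.Walk.edges_copy, SimpleGraph.Walk.cons_isPath_iff,
    SimpleGraph.Walk.isPath_copy, SimpleGraph.Walk.support_copy, SimpleGraph.Walk.edges_cons,
    SimpleGraph.Walk.edges_copy, List.mem_cons, not_or]
  refine ⟨⟨isPath_alternatingWalk c hadj hadj' hinv k _ fun i hi j hj h => ?_, hnot⟩, ?_,
    fun h => hnot (SimpleGraph.Walk.snd_mem_support_of_mem_edges _ h)⟩
  · have hinj : ∀ i ≤ k, ∀ j ≤ k, i ≤ j → (m' ∘ m)^[i + 1] x = (m' ∘ m)^[j + 1] x → i = j := by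
      intro i hi j hj hij h
      rcases hj.lt_or_eq with hj | rfl
      · have := hx (x₁ := i + 1) (x₂ := j + 1) (by simp; omega) (by simpa using hj) h
        omega
      · rcases hi.lt_or_eq with hi | rfl
        · exact absurd (h.trans hper) (hk i hi)
        · rfl
    rcases le_total i j with hij | hij
    · exact hinj i hi j hj hij h
    · exact (hinj j hj i hi hij h.symm).symm
  · intro h
    rcases Sym2.eq_iff.1 h with h | h
    · exact (hadj x).ne h.1
    · exact hne h.1.symm

/-- If every cycle of a finite bipartite simple graph has nonzero circulation, then the
graph has at most one perfect matching of minimum total weight. -/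
theorem min_weight_perfect_matching_unique {V : Type*} [Fintype V]
    (G : SimpleGraph V) (hbip : G.Colorable 2) (w : Sym2 V → ℤ)
    (hcirc : ∀ (v : V) (C : G.Walk v v), C.IsCycle → (C.edges.map w).alternatingSum ≠ 0)
    (M₁ M₂ : Finset (Sym2 V))
    (h₁ : IsPerfectMatching' G M₁) (h₂ : IsPerfectMatching' G M₂)
    (hmin₁ : ∀ M, IsPerfectMatching' G M → ∑ e ∈ M₁, w e ≤ ∑ e ∈ M, w e)
    (hmin₂ : ∀ M, IsPerfectMatching' G M → ∑ e ∈ M₂, w e ≤ ∑ e ∈ M, w e) :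
    M₁ = M₂ := by
  classical
  obtain ⟨c⟩ := hbip
  obtain ⟨m, hadj, hinv, hiff⟩ := h₁.exists_partner
  obtain ⟨m', hadj', hinv', hiff'⟩ := h₂.exists_partner
  suffices hmm : ∀ x, m' (m x) = x by
    ext e
    induction e using Sym2.ind with
    | _ x y =>
      rw [hiff, hiff', ← hmm x, hinv', hmm x]
  by_contra! hne
  obtain ⟨v, hv⟩ := hne
  have hinj : Function.Injective (m' ∘ m) :=
    (Function.Involutive.injective hinv').comp (Function.Involutive.injective hinv)
  have hpos : 0 < Function.minimalPeriod (m' ∘ m) v :=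
    Function.minimalPeriod_pos_of_mem_periodicPts (hinj.mem_periodicPts v)
  have hper : (m' ∘ m)^[Function.minimalPeriod (m' ∘ m) v] v = v :=
    Function.isPeriodicPt_minimalPeriod _ v
  have hIio := Function.iterate_injOn_Iio_minimalPeriod (f := m' ∘ m) (x := v)
  have hmod : ∀ i, (m' ∘ m)^[i % Function.minimalPeriod (m' ∘ m) v] v = (m' ∘ m)^[i] v :=
    fun i => Function.iterate_mod_minimalPeriod_eq
  obtain ⟨k, hk⟩ := Nat.exists_eq_add_one.2 hpos
  rw [hk] at hper hIio
  simp only [hk] at hmod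
  let O : V → Prop := fun x => ∃ i, (m' ∘ m)^[i] v = x
  have hOf : ∀ x, O x → O (m' (m x)) := by
    rintro _ ⟨i, rfl⟩
    exact ⟨i + 1, Function.iterate_succ_apply' _ _ _⟩
  have hOb : ∀ x, O x → O (m (m' x)) := by
    rintro _ ⟨i, rfl⟩
    refine ⟨i + k, ?_⟩
    nth_rewrite 2 [← hper]
    rw [← Function.iterate_add_apply, ← add_assoc, Function.iterate_succ_apply']
    simp only [Function.comp_apply, hinv, hinv']
  let S : V → Prop := fun x => O x ∨ O (m x)
  have hS : ∀ x, S x → S (m x) := by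
    rintro x (hx | hx)
    · exact .inr (by rwa [hinv])
    · exact .inl hx
  have hS' : ∀ x, S x → S (m' x) := by
    rintro x (hx | hx)
    · exact .inr (hOb x hx)
    · exact .inl (by simpa only [hinv] using hOf _ hx)
  have heq : ∑ x with c x = c v ∧ S x, w s(x, m x) = ∑ x with c x = c v ∧ S x, w s(x, m' x) :=
    le_antisymm
      (sum_partner_le_of_invariant c (c v) w hmin₁ hadj hinv hiff hadj' hinv' S hS hS')
      (sum_partner_le_of_invariant c (c v) w hmin₂ hadj' hinv' hiff' hadj hinv S hS' hS)
  have hsum : ∀ g : V → ℤ, ∑ x with c x = c v ∧ S x, g x =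
      ∑ i ∈ Finset.range (k + 1), g ((m' ∘ m)^[i] v) := by
    intro g
    symm
    refine Finset.sum_nbij (fun i => (m' ∘ m)^[i] v) ?_ ?_ ?_ fun _ _ => rfl
    · intro i _
      exact Finset.mem_filter.2 ⟨Finset.mem_univ _,
        color_iterate_partner_comp c hadj hadj' i v, .inl ⟨i, rfl⟩⟩
    · simpa using hIio
    · intro x hx
      obtain ⟨-, hc, ⟨i, rfl⟩ | ⟨i, hi⟩⟩ := Finset.mem_filter.1 hx
      · exact ⟨i % (k + 1), by simpa using Nat.mod_lt _ k.succ_pos, hmod i⟩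
      · have := color_iterate_partner_comp c hadj hadj' i v
        rw [hi, ← hc] at this
        exact absurd this.symm (c.valid (hadj x))
  refine hcirc v _ (isCycle_copy_alternatingWalk c hadj hadj' hinv k v hper hv hIio) ?_
  rw [SimpleGraph.Walk.edges_copy, alternatingSum_edges_alternatingWalk, Finset.sum_sub_distrib]
  rw [hsum, hsum] at heq
  rw [heq, sub_eq_zero]
  have hshift : ∀ i, w s(m ((m' ∘ m)^[i] v), (m' ∘ m)^[i + 1] v) =
      w s((m' ∘ m)^[i + 1] v, m' ((m' ∘ m)^[i + 1] v)) := by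
    intro i
    rw [Sym2.eq_swap, Function.iterate_succ_apply', Function.comp_apply, hinv']
  simp only [hshift]
  have h := (Finset.sum_range_succ (fun i => w s((m' ∘ m)^[i] v, m' ((m' ∘ m)^[i] v)))
    (k + 1)).symm.trans (Finset.sum_range_succ' _ (k + 1))
  rw [hper] at h
  exact add_right_cancel h
end

section
/- Let G be a simple graph on n vertices and let A be its adjacency matrix regarded as a matrix over the field with two elements (ℤ/2ℤ). Then det(A) equals the number of perfect matchings of G modulo 2. -/
/-- Over the field with two elements, the determinant of a symmetric matrix is the sum of the
diagonal products over the involutive permutations only. -/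
theorem Matrix.IsSymm.det_eq_sum_involutive {V : Type*} [Fintype V] [DecidableEq V]
    {A : Matrix V V (ZMod 2)} (hA : A.IsSymm) :
    A.det = ∑ σ : Equiv.Perm V with σ⁻¹ = σ, ∏ i, A (σ i) i := by
  have hsign (σ : Equiv.Perm V) (x : ZMod 2) : Equiv.Perm.sign σ • x = x := by
    rcases Int.units_eq_one_or (Equiv.Perm.sign σ) with h | h <;>
      simp [h, Units.smul_def, ZMod.neg_eq_self_mod_two]
  have hprod (σ : Equiv.Perm V) : ∏ i, A (σ⁻¹ i) i = ∏ i, A (σ i) i := by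
    rw [← Equiv.prod_comp σ]
    exact Finset.prod_congr rfl fun i _ => by rw [Equiv.Perm.inv_def, Equiv.symm_apply_apply, hA.apply]
  rw [Matrix.det_apply, ← Finset.sum_filter_add_sum_filter_not _ (fun σ => σ⁻¹ = σ)]
  simp only [hsign, add_eq_left]
  refine Finset.sum_involution (fun σ _ => σ⁻¹) (fun σ _ => ?_) (fun σ hσ _ => ?_)
    (fun σ hσ => ?_) (fun σ _ => inv_inv σ)
  · rw [hprod, CharTwo.add_self_eq_zero]
  · exact (Finset.mem_filter.mp hσ).2
  · simpa [eq_comm] using hσ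

/-- The involutive permutations moving every vertex to a neighbour are equinumerous with the
perfect matchings. -/
theorem card_involutive_adj_eq_ncard_isPerfectMatching' {V : Type*} [Fintype V] [DecidableEq V]
    (G : SimpleGraph V) [DecidableRel G.Adj] :
    Finset.card {σ : Equiv.Perm V | σ⁻¹ = σ ∧ ∀ i, G.Adj (σ i) i} =
      {M : Finset (Sym2 V) | IsPerfectMatching' G M}.ncard := by
  have hσσ {σ : Equiv.Perm V} (hinv : σ⁻¹ = σ) (i : V) : σ (σ i) = i := by
    nth_rewrite 1 [← hinv]
    exact σ.symm_apply_apply i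
  rw [← Set.ncard_coe_finset]
  refine Set.ncard_congr (fun σ _ => Finset.univ.image fun i => s(i, σ i)) ?_ ?_ ?_
  · intro σ hσ
    simp only [Finset.coe_filter, Finset.mem_univ, true_and, Set.mem_ofPred_eq] at hσ
    obtain ⟨hinv, hadj⟩ := hσ
    refine ⟨?_, fun v => ⟨s(v, σ v), by simp, ?_⟩⟩
    · simpa using fun i => (hadj i).symm
    · rintro e ⟨he, hv⟩
      obtain ⟨i, -, rfl⟩ := Finset.mem_image.mp he
      rcases Sym2.mem_iff.mp hv with rfl | rfl
      · rfl
      · rw [hσσ hinv, Sym2.eq_swap]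
  · intro σ τ hσ hτ h
    simp only [Finset.coe_filter, Finset.mem_univ, true_and, Set.mem_ofPred_eq] at hσ hτ
    ext v
    have hv : s(v, σ v) ∈ Finset.univ.image fun i => s(i, τ i) := h ▸ by simp
    obtain ⟨i, -, hi⟩ := Finset.mem_image.mp hv
    rcases Sym2.eq_iff.mp hi with ⟨rfl, h'⟩ | ⟨h', rfl⟩
    · exact h'.symm
    · rw [← h', hσσ hτ.1]
  · rintro M ⟨hM, hex⟩
    have hpartner (v : V) : ∃ w, s(v, w) ∈ M := by
      obtain ⟨e, ⟨he, w, rfl⟩, -⟩ := hex v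
      exact ⟨w, he⟩
    choose f hf using hpartner
    have huniq {v w : V} (h : s(v, w) ∈ M) : f v = w :=
      Sym2.congr_right.mp ((hex v).unique ⟨hf v, by simp⟩ ⟨h, by simp⟩)
    have hinvol : Function.Involutive f := fun v => huniq (Sym2.eq_swap ▸ hf v)
    refine ⟨hinvol.toPerm, ?_, ?_⟩
    · simp only [Finset.coe_filter, Finset.mem_univ, true_and, Set.mem_ofPred_eq]
      exact ⟨rfl, fun i => (hM _ (hf i)).symm⟩
    · ext e
      induction e with | h v w => ?_
      simp only [Finset.mem_image, Finset.mem_univ, true_and, Function.Involutive.coe_toPerm]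
      exact ⟨fun ⟨i, hi⟩ => hi ▸ hf i, fun h => ⟨v, by rw [huniq h]⟩⟩

/-- The determinant of the adjacency matrix of a simple graph on `n` vertices, over the
field with two elements, equals the number of perfect matchings of the graph modulo 2. -/
theorem det_adjMatrix_eq_card_perfectMatchings_mod_two (n : ℕ)
    (G : SimpleGraph (Fin n)) [DecidableRel G.Adj] :
    (G.adjMatrix (ZMod 2)).det
      = (({M : Finset (Sym2 (Fin n)) | IsPerfectMatching' G M}.ncard : ℕ) : ZMod 2) := by
  rw [G.isSymm_adjMatrix.det_eq_sum_involutive,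
    ← card_involutive_adj_eq_ncard_isPerfectMatching', ← Finset.filter_filter,
    Finset.natCast_card_filter]
  simp only [SimpleGraph.adjMatrix_apply, Finset.prod_ite_zero, Finset.mem_univ, true_imp_iff,
    Finset.prod_const_one]
  congr!
end

section
/- Let M be a perfect matching of a finite simple graph G. Then M is the unique perfect matching of G if and only if G contains no M-alternating cycle, i.e., no cycle of even length whose edges, taken in order, lie alternately in M and in E(G) \ M. -/
namespace IsPerfectMatching'

variable {V : Type*} {G : SimpleGraph V} {M M' : Finset (Sym2 V)}

theorem exists_mem (hM : IsPerfectMatching' G M) (v : V) : ∃ w, s(v, w) ∈ M := by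
  obtain ⟨e, ⟨he, w, rfl⟩, -⟩ := hM.2 v
  exact ⟨w, he⟩

theorem eq_of_mem (hM : IsPerfectMatching' G M) {v a b : V} (ha : s(v, a) ∈ M)
    (hb : s(v, b) ∈ M) : a = b :=
  Sym2.congr_right.1 <| (hM.2 v).unique ⟨ha, Sym2.mem_mk_left v a⟩ ⟨hb, Sym2.mem_mk_left v b⟩

theorem of_existsUnique (hG : ∀ e ∈ M, e ∈ G.edgeSet) (h : ∀ v, ∃! w, s(v, w) ∈ M) :
    IsPerfectMatching' G M := by
  refine ⟨hG, fun v => ?_⟩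
  obtain ⟨w, hw, huniq⟩ := h v
  refine ⟨s(v, w), ⟨hw, Sym2.mem_mk_left v w⟩, ?_⟩
  rintro _ ⟨he, u, rfl⟩
  rw [huniq u he]

/-- A perfect matching contained in another one is equal to it. -/
theorem eq_of_subset (hM : IsPerfectMatching' G M) (hM' : IsPerfectMatching' G M')
    (h : M ⊆ M') : M = M' := by
  refine h.antisymm fun e => ?_
  induction e with | _ v w
  intro he
  obtain ⟨u, hu⟩ := hM.exists_mem v
  rwa [hM'.eq_of_mem he (h hu)]

theorem isCycles_symmDiff [DecidableEq V] (hM : IsPerfectMatching' G M)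
    (hM' : IsPerfectMatching' G M') :
    (SimpleGraph.fromEdgeSet (symmDiff M M' : Set (Sym2 V))).IsCycles := by
  intro v hv
  obtain ⟨a, ha⟩ := hM.exists_mem v
  obtain ⟨b, hb⟩ := hM'.exists_mem v
  have hne : ∀ w, s(v, w) ∈ M ∨ s(v, w) ∈ M' → v ≠ w := fun w hw =>
    G.ne_of_adj (hw.elim (hM.1 _) (hM'.1 _))
  have hiffa : ∀ w, s(v, w) ∈ M ↔ w = a := fun w => ⟨fun h => hM.eq_of_mem h ha, (· ▸ ha)⟩
  have hiffb : ∀ w, s(v, w) ∈ M' ↔ w = b := fun w => ⟨fun h => hM'.eq_of_mem h hb, (· ▸ hb)⟩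
  have hab : a ≠ b := by
    rintro rfl
    obtain ⟨w, hw⟩ := hv
    simp [Set.mem_symmDiff, hiffa, hiffb] at hw
  have : (SimpleGraph.fromEdgeSet (symmDiff M M' : Set (Sym2 V))).neighborSet v = {a, b} := by
    ext w
    have := hne w
    simp only [SimpleGraph.mem_neighborSet, SimpleGraph.fromEdgeSet_adj, Set.mem_symmDiff,
      Finset.mem_coe, hiffa, hiffb, Set.mem_insert_iff, Set.mem_singleton_iff] at this ⊢
    grind
  rw [this, Set.ncard_pair hab]

end IsPerfectMatching'

namespace SimpleGraph.Walk.IsCycle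

variable {V : Type*} {G : SimpleGraph V} {M : Finset (Sym2 V)} {v : V} {C : G.Walk v v}

/-- If any two distinct edges of a cycle sharing a vertex alternate with respect to `M`,
then so do the first and the last edge. -/
theorem mem_first_iff_notMem_last (hC : C.IsCycle)
    (h : ∀ a b c, a ≠ c → s(a, b) ∈ C.edges → s(b, c) ∈ C.edges → (s(a, b) ∈ M ↔ s(b, c) ∉ M)) :
    s(C.getVert 0, C.getVert 1) ∈ M ↔ s(C.getVert (C.length - 1), C.getVert C.length) ∉ M := by
  have h3 := hC.three_le_length
  have he : ∀ i < C.length, s(C.getVert i, C.getVert (i + 1)) ∈ C.edges := fun i hi => by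
    rw [← C.getElem_edges (by simpa using hi)]
    exact List.getElem_mem _
  have hlast := he (C.length - 1) (by lia)
  have hfirst := he 0 (by lia)
  rw [Nat.sub_add_cancel (by lia)] at hlast
  simp only [zero_add, getVert_zero, getVert_length] at hlast hfirst ⊢
  have hne : C.getVert (C.length - 1) ≠ C.getVert 1 := hC.snd_ne_penultimate.symm
  have := h _ _ _ hne hlast hfirst
  tauto

theorem alternating_of_mem_first (hC : C.IsCycle)
    (h : ∀ a b c, a ≠ c → s(a, b) ∈ C.edges → s(b, c) ∈ C.edges → (s(a, b) ∈ M ↔ s(b, c) ∉ M))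
    (h0 : s(C.getVert 0, C.getVert 1) ∈ M) :
    Even C.length ∧ ∀ (k : ℕ) (hk : k < C.edges.length),
      (Even k → C.edges.get ⟨k, hk⟩ ∈ M) ∧ (Odd k → C.edges.get ⟨k, hk⟩ ∉ M) := by
  have h3 := hC.three_le_length
  have key : ∀ k (hk : k < C.edges.length), C.edges[k] ∈ M ↔ Even k := by
    intro k
    induction k with
    | zero =>
      intro hk
      simpa [getElem_edges] using h0
    | succ k ih =>
      intro hk
      have hne : C.getVert k ≠ C.getVert (k + 1 + 1) := by
        intro heq
        have : C.edges[k] = C.edges[k + 1] := by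
          rw [getElem_edges, getElem_edges, heq, Sym2.eq_swap]
        have := (hC.edges_nodup.getElem_inj_iff).1 this
        lia
      have hk' : k < C.edges.length := by lia
      have := h (C.getVert k) (C.getVert (k + 1)) (C.getVert (k + 1 + 1)) hne
        (by rw [← getElem_edges hk']; exact List.getElem_mem _)
        (by rw [← getElem_edges hk]; exact List.getElem_mem _)
      rw [← getElem_edges hk', ← getElem_edges hk, ih hk'] at this
      rw [Nat.even_add_one]
      tauto
  refine ⟨?_, fun k hk => ⟨fun hev => (key k hk).2 hev, fun hodd hmem => ?_⟩⟩
  · have hlast := (hC.mem_first_iff_notMem_last h).1 h0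
    have hk := key (C.length - 1) (by rw [length_edges]; lia)
    rw [getElem_edges, Nat.sub_add_cancel (by lia)] at hk
    grind
  · exact Nat.not_even_iff_odd.2 hodd ((key k hk).1 hmem)

/-- On an alternating cycle, each vertex has exactly two neighbours, one through an edge in `M`
and the other through an edge outside of `M`. -/
theorem exists_neighborSet_eq_of_alternating (hC : C.IsCycle) (heven : Even C.length)
    (halt : ∀ (k : ℕ) (hk : k < C.edges.length),
      (Even k → C.edges.get ⟨k, hk⟩ ∈ M) ∧ (Odd k → C.edges.get ⟨k, hk⟩ ∉ M))
    {u : V} (hu : u ∈ C.support) :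
    ∃ a b, s(u, a) ∈ M ∧ s(u, b) ∉ M ∧ ∀ w, s(u, w) ∈ C.edges ↔ w = a ∨ w = b := by
  have h3 := hC.three_le_length
  have key : ∀ k < C.length, (s(C.getVert k, C.getVert (k + 1)) ∈ M ↔ Even k) := by
    intro k hk
    have hk' : k < C.edges.length := by rwa [length_edges]
    have := halt k hk'
    rw [List.get_eq_getElem, getElem_edges] at this
    grind
  obtain ⟨i, rfl, hi⟩ := mem_support_iff_exists_getVert.1 hu
  have hnbr : ∀ w, s(C.getVert i, w) ∈ C.edges ↔ w ∈ C.toSubgraph.neighborSet (C.getVert i) :=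
    fun w => by rw [Subgraph.mem_neighborSet, adj_toSubgraph_iff_mem_edges]
  by_cases hend : i = 0 ∨ i = C.length
  · have hiv : C.getVert i = v := by rcases hend with rfl | rfl <;> simp
    rw [hiv] at hnbr ⊢
    rw [hC.neighborSet_toSubgraph_endpoint] at hnbr
    have h0 := key 0 (by lia)
    have hlast := key (C.length - 1) (by lia)
    rw [Nat.sub_add_cancel (by lia), getVert_length, Sym2.eq_swap] at hlast
    rw [getVert_zero] at h0
    refine ⟨C.snd, C.penultimate, by simpa using h0, fun hmem => ?_, by simpa using hnbr⟩
    have := hlast.1 hmem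
    grind
  · push Not at hend
    rw [hC.neighborSet_toSubgraph_internal hend.1 (by lia)] at hnbr
    have hnext := key i (by lia)
    have hprev := key (i - 1) (by lia)
    rw [Nat.sub_add_cancel (by lia), Sym2.eq_swap] at hprev
    simp only [Set.mem_insert_iff, Set.mem_singleton_iff] at hnbr
    rcases Nat.even_or_odd i with hpar | hpar
    · exact ⟨_, _, hnext.2 hpar, fun hmem => by grind, fun w => (hnbr w).trans or_comm⟩
    · exact ⟨_, _, hprev.2 (by grind), fun hmem => by grind, hnbr⟩

end SimpleGraph.Walk.IsCycle

namespace IsPerfectMatching'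

variable {V : Type*} {G : SimpleGraph V} {M M' : Finset (Sym2 V)}

/-- Exchanging the edges of a perfect matching along an alternating cycle gives a perfect
matching. -/
theorem symmDiff_alternating_cycle [DecidableEq V] (hM : IsPerfectMatching' G M) {v : V}
    {C : G.Walk v v} (hC : C.IsCycle) (heven : Even C.length)
    (halt : ∀ (k : ℕ) (hk : k < C.edges.length),
      (Even k → C.edges.get ⟨k, hk⟩ ∈ M) ∧ (Odd k → C.edges.get ⟨k, hk⟩ ∉ M)) :
    IsPerfectMatching' G (symmDiff M C.edges.toFinset) := by
  refine of_existsUnique (fun e he => ?_) fun u => ?_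
  · rcases Finset.mem_symmDiff.1 he with he | he
    · exact hM.1 e he.1
    · exact C.edges_subset_edgeSet (List.mem_toFinset.1 he.1)
  · simp only [Finset.mem_symmDiff, List.mem_toFinset]
    by_cases hu : u ∈ C.support
    · obtain ⟨a, b, ha, hb, hnbr⟩ := hC.exists_neighborSet_eq_of_alternating heven halt hu
      refine ⟨b, Or.inr ⟨(hnbr b).2 (Or.inr rfl), hb⟩, ?_⟩
      rintro w (⟨hw, hwC⟩ | ⟨hwC, hw⟩)
      · exact absurd ((hnbr w).2 (Or.inl (hM.eq_of_mem hw ha))) hwC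
      · exact ((hnbr w).1 hwC).resolve_left (by rintro rfl; exact hw ha)
    · have hnot : ∀ w, s(u, w) ∉ C.edges := fun w hw => hu (C.fst_mem_support_of_mem_edges hw)
      obtain ⟨a, ha⟩ := hM.exists_mem u
      refine ⟨a, Or.inl ⟨ha, hnot a⟩, ?_⟩
      rintro w (⟨hw, -⟩ | ⟨hwC, -⟩)
      · exact hM.eq_of_mem hw ha
      · exact absurd hwC (hnot w)

theorem exists_alternating_cycle_of_ne [Finite V] (hM : IsPerfectMatching' G M)
    (hM' : IsPerfectMatching' G M') (hne : M' ≠ M) :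
    ∃ (v : V) (C : G.Walk v v), C.IsCycle ∧ Even C.length ∧
      ∀ (k : ℕ) (hk : k < C.edges.length),
        (Even k → C.edges.get ⟨k, hk⟩ ∈ M) ∧ (Odd k → C.edges.get ⟨k, hk⟩ ∉ M) := by
  classical
  set H := SimpleGraph.fromEdgeSet (symmDiff M M' : Set (Sym2 V))
  have hHG : H ≤ G := by
    intro a b hab
    rcases (SimpleGraph.fromEdgeSet_adj _).1 hab with ⟨hab | hab, -⟩
    · exact hM.1 _ hab.1
    · exact hM'.1 _ hab.1
  obtain ⟨v, hv⟩ : ∃ v, (H.neighborSet v).Nonempty := by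
    obtain ⟨e, he, he'⟩ := Finset.not_subset.1 fun h => hne (hM'.eq_of_subset hM h)
    induction e with | _ v w
    exact ⟨v, w, (SimpleGraph.fromEdgeSet_adj _).2 ⟨Or.inr ⟨he, he'⟩, G.ne_of_adj (hM'.1 _ he)⟩⟩
  have hcycles : H.IsCycles := hM.isCycles_symmDiff hM'
  obtain ⟨p, hp, -⟩ := hcycles.exists_cycle_toSubgraph_verts_eq_connectedComponentSupp
    (c := H.connectedComponentMk v) rfl hv
  have halt : ∀ a b c, a ≠ c → s(a, b) ∈ (p.mapLe hHG).edges → s(b, c) ∈ (p.mapLe hHG).edges →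
      (s(a, b) ∈ M ↔ s(b, c) ∉ M) := by
    intro a b c hac hab hbc
    rw [SimpleGraph.Walk.edges_mapLe_eq_edges] at hab hbc
    have hab := ((SimpleGraph.fromEdgeSet_adj _).1 (p.adj_of_mem_edges hab)).1
    have hbc := ((SimpleGraph.fromEdgeSet_adj _).1 (p.adj_of_mem_edges hbc)).1
    rw [Sym2.eq_swap] at hab ⊢
    simp only [Set.mem_symmDiff, Finset.mem_coe] at hab hbc
    have h1 := fun h h' => hac (hM.eq_of_mem (v := b) (a := a) (b := c) h h')
    have h2 := fun h h' => hac (hM'.eq_of_mem (v := b) (a := a) (b := c) h h')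
    tauto
  have hC := hp.mapLe hHG
  generalize p.mapLe hHG = C at hC halt
  by_cases h0 : s(C.getVert 0, C.getVert 1) ∈ M
  · exact ⟨v, C, hC, hC.alternating_of_mem_first halt h0⟩
  · refine ⟨v, C.reverse, hC.reverse, hC.reverse.alternating_of_mem_first (by simpa using halt) ?_⟩
    rw [hC.mem_first_iff_notMem_last halt, not_not, Sym2.eq_swap] at h0
    simpa [SimpleGraph.Walk.getVert_reverse] using h0

end IsPerfectMatching'

/-- A perfect matching `M` of a finite simple graph `G` is the unique perfect matching of
`G` if and only if `G` contains no `M`-alternating cycle, i.e. no cycle of even length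
whose edges, taken in order, lie alternately in `M` and in `E(G) \ M`. -/
theorem unique_perfect_matching_iff_no_alternating_cycle {V : Type*} [Fintype V]
    (G : SimpleGraph V) (M : Finset (Sym2 V)) (hM : IsPerfectMatching' G M) :
    (∀ M', IsPerfectMatching' G M' → M' = M) ↔
      ¬ ∃ (v : V) (C : G.Walk v v), C.IsCycle ∧ Even C.length ∧
        ∀ (k : ℕ) (hk : k < C.edges.length),
          (Even k → C.edges.get ⟨k, hk⟩ ∈ M) ∧
          (Odd k → C.edges.get ⟨k, hk⟩ ∉ M) := by
  classical
  constructor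
  · rintro huniq ⟨v, C, hC, heven, halt⟩
    have := huniq _ (hM.symmDiff_alternating_cycle hC heven halt)
    rw [symmDiff_eq_left, Finset.bot_eq_empty, List.toFinset_eq_empty_iff,
      SimpleGraph.Walk.edges_eq_nil] at this
    exact hC.not_nil this
  · intro hnone M' hM'
    by_contra hne
    exact hnone (hM.exists_alternating_cycle_of_ne hM' hne)
end
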